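/- Let V ∈ B(H) be a unilateral shift with wandering space (𝓛, m) and let 0 ≤ t ≤ m. Then the subspace 𝒞_t := 𝓛 ∩ (ker V^t)ᗮ is nonzero, and {V^0, V^1, …, V^t} is a 𝒞_t-decoding noise basis of 𝒩_t := span{V^j : 0 ≤ j ≤ t}; in particular, 𝒞_t is a quantum 𝒩_t-correcting code. -/

import Mathlib

open scoped InnerProductSpace ComplexConjugate ComplexOrder
open LinearMap Submodule

noncomputable section

variable {H : Type} [NormedAddCommGroup H] [InnerProductSpace ℂ H] [FiniteDimensional ℂ H]

/-- The support of an operator. -/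
def supp (T : H →ₗ[ℂ] H) : Submodule ℂ H := (LinearMap.ker T)ᗮ

/-- The orthogonal projection onto a subspace, as an operator on `H`. -/
def projOf (C : Submodule ℂ H) : H →ₗ[ℂ] H :=
  C.subtype ∘ₗ (orthogonalProjection C).toLinearMap

/-- `V` is a partial isometry. -/
def IsPartialIsometry (V : H →ₗ[ℂ] H) : Prop :=
  LinearMap.adjoint V ∘ₗ V = projOf (supp V)

/-- `V` is unitary. -/
def IsUnitaryOp (V : H →ₗ[ℂ] H) : Prop :=
  LinearMap.adjoint V ∘ₗ V = LinearMap.id ∧ V ∘ₗ LinearMap.adjoint V = LinearMap.id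

/-- `(L, m)` is a wandering space for `V`:  `L ≠ 0`, `m = max {n : V^n L ≠ 0}`, and
`V^n L ⊥ L` for all `n ≥ 1`. -/
def IsWandering (V : H →ₗ[ℂ] H) (L : Submodule ℂ H) (m : ℕ) : Prop :=
  L ≠ ⊥ ∧ Submodule.map (V ^ m) L ≠ ⊥ ∧ (∀ n : ℕ, m < n → Submodule.map (V ^ n) L = ⊥) ∧
  ∀ n : ℕ, 1 ≤ n → ∀ x ∈ L, ∀ y ∈ Submodule.map (V ^ n) L, ⟪x, y⟫_ℂ = 0

/-- `V` restricted to `K` is a unilateral shift with wandering space `(L, m)`: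
`K = L ⊕ V L ⊕ ⋯ ⊕ V^m L`, an orthogonal direct sum. -/
def IsShiftOnWith (V : H →ₗ[ℂ] H) (K : Submodule ℂ H) (L : Submodule ℂ H) (m : ℕ) : Prop :=
  IsWandering V L m ∧
  (∀ j k : ℕ, j ≠ k →
    ∀ x ∈ Submodule.map (V ^ j) L, ∀ y ∈ Submodule.map (V ^ k) L, ⟪x, y⟫_ℂ = 0) ∧
  (⨆ j : Fin (m + 1), Submodule.map (V ^ (j : ℕ)) L) = K

/-- `V` restricted to `K` is a unilateral shift (of `K`). -/
def IsShiftOn (V : H →ₗ[ℂ] H) (K : Submodule ℂ H) : Prop :=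
  ∃ (L : Submodule ℂ H) (m : ℕ), IsShiftOnWith V K L m

/-- The restriction of `V` to `K` is unitary: `V` maps `K` onto `K` isometrically. -/
def IsUnitaryOn (V : H →ₗ[ℂ] H) (K : Submodule ℂ H) : Prop :=
  Submodule.map V K = K ∧ ∀ x ∈ K, ‖V x‖ = ‖x‖

/-- `K` reduces `V`: both `K` and `Kᗮ` are `V`-invariant. -/
def Reduces (K : Submodule ℂ H) (V : H →ₗ[ℂ] H) : Prop :=
  Submodule.map V K ≤ K ∧ Submodule.map V Kᗮ ≤ Kᗮ

/-- `V` is a partial isometry onto `F`. -/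
def IsPartialIsometryOnto (V : H →ₗ[ℂ] H) (F : Submodule ℂ H) : Prop :=
  IsPartialIsometry V ∧ supp V = F

/-- A state supported in `C`. -/
def IsStateOn (C : Submodule ℂ H) (ρ : H →ₗ[ℂ] H) : Prop :=
  LinearMap.adjoint ρ = ρ ∧ (∀ x : H, 0 ≤ ⟪x, ρ x⟫_ℂ) ∧
    LinearMap.trace ℂ H ρ = 1 ∧ supp ρ ≤ C

/-- A quantum channel: a map given by Kraus operators `K_j` with `Σ K_j* K_j = I`. -/
def IsQuantumChannel (Φ : (H →ₗ[ℂ] H) → (H →ₗ[ℂ] H)) : Prop :=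
  ∃ (n : ℕ) (K : Fin n → (H →ₗ[ℂ] H)),
    (∑ j, LinearMap.adjoint (K j) ∘ₗ K j) = LinearMap.id ∧
    ∀ ρ, Φ ρ = ∑ j, K j ∘ₗ ρ ∘ₗ LinearMap.adjoint (K j)

/-- `Φ` is a quantum channel decoding the code `C` against the noise `𝒩`. -/
def Decodes (𝒩 : Submodule ℂ (H →ₗ[ℂ] H)) (C : Submodule ℂ H)
    (Φ : (H →ₗ[ℂ] H) → (H →ₗ[ℂ] H)) : Prop :=
  IsQuantumChannel Φ ∧ ∀ ρ : H →ₗ[ℂ] H, IsStateOn C ρ → ∀ N ∈ 𝒩,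
    Φ (N ∘ₗ ρ ∘ₗ LinearMap.adjoint N) =
      LinearMap.trace ℂ H (ρ ∘ₗ LinearMap.adjoint N ∘ₗ N) • ρ

/-- A family `{N_j}` is a `C`-decoding noise basis (of its span): it is linearly
independent, each `N_j P_C` is a partial isometry onto `C`, and `N_j C ⊥ N_k C`
for `j ≠ k`. -/
def IsDecodingNoiseBasis (C : Submodule ℂ H) {ι : Type} (Nb : ι → (H →ₗ[ℂ] H)) : Prop :=
  LinearIndependent ℂ Nb ∧
  (∀ j, IsPartialIsometryOnto (Nb j ∘ₗ projOf C) C) ∧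
  ∀ j k, j ≠ k → ∀ u ∈ C, ∀ v ∈ C, ⟪Nb j u, Nb k v⟫_ℂ = 0

lemma projOf_mem (C : Submodule ℂ H) (x : H) : projOf C x ∈ C := by
  simp [projOf]

lemma projOf_of_mem (C : Submodule ℂ H) {x : H} (hx : x ∈ C) : projOf C x = x := by
  have := Submodule.starProjection_eq_self_iff.2 hx
  simpa [projOf] using this

lemma sub_projOf_mem (C : Submodule ℂ H) (x : H) : x - projOf C x ∈ Cᗮ :=
  Submodule.sub_starProjection_mem_orthogonal (K := C) x

lemma projOf_mul_self (C : Submodule ℂ H) : projOf C * projOf C = projOf C := by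
  ext x
  exact projOf_of_mem C (projOf_mem C x)

lemma projOf_inner (C : Submodule ℂ H) (x y : H) :
    ⟪projOf C x, y⟫_ℂ = ⟪x, projOf C y⟫_ℂ :=
  Submodule.inner_starProjection_left_eq_right C x y

lemma projOf_star (C : Submodule ℂ H) : star (projOf C) = projOf C := by
  rw [LinearMap.star_eq_adjoint, eq_comm, LinearMap.eq_adjoint_iff]
  exact projOf_inner C

lemma ker_projOf (C : Submodule ℂ H) : LinearMap.ker (projOf C) = Cᗮ := by
  ext x
  rw [LinearMap.mem_ker]
  constructor
  · intro h
    simpa [h] using sub_projOf_mem C x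
  · intro h
    have h2 : projOf C x ∈ Cᗮ := by
      have := Submodule.sub_mem _ h (sub_projOf_mem C x)
      simpa using this
    have := Submodule.inner_right_of_mem_orthogonal (projOf_mem C x) h2
    exact inner_self_eq_zero.1 this

/-- Kernels of powers are graded. -/
lemma graded_ker (V : H →ₗ[ℂ] H) (L : Submodule ℂ H) (m : ℕ)
    (hshift : IsShiftOnWith V (⊤ : Submodule ℂ H) L m) (s j : ℕ) (hj : j ≤ m)
    (y : H) (hy : (V ^ s) y = 0) :
    ∃ z ∈ L, (V ^ (s + j)) z = 0 ∧
      ∀ w ∈ Submodule.map (V ^ j) L, ⟪w, y⟫_ℂ = ⟪w, (V ^ j) z⟫_ℂ := by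
  obtain ⟨-, hort, htop⟩ := hshift
  have hy' : y ∈ ⨆ j : Fin (m + 1), Submodule.map (V ^ (j : ℕ)) L := htop ▸ Submodule.mem_top
  obtain ⟨f, hf, hsum⟩ := (Submodule.mem_iSup_iff_exists_finsupp _ _).1 hy'
  have hsum' : ∑ i, f i = y := by
    rw [← hsum, Finsupp.sum_fintype _ _ (by simp)]
  have hV : ∀ i : Fin (m + 1), (V ^ s) (f i) ∈ Submodule.map (V ^ (s + (i : ℕ))) L := by
    intro i
    obtain ⟨z, hz, hz'⟩ := hf i
    exact ⟨z, hz, by rw [pow_add, Module.End.mul_apply, hz']⟩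
  obtain ⟨z, hz, hz'⟩ := hf ⟨j, by omega⟩
  refine ⟨z, hz, ?_, ?_⟩
  · rw [pow_add, Module.End.mul_apply]
    simp only at hz'
    rw [hz']
    have h0 : ∑ i, (V ^ s) (f i) = 0 := by rw [← map_sum, hsum', hy]
    have h1 : ⟪(V ^ s) (f ⟨j, by omega⟩), ∑ i, (V ^ s) (f i)⟫_ℂ = 0 := by rw [h0, inner_zero_right]
    rw [inner_sum, Finset.sum_eq_single ⟨j, by omega⟩] at h1
    · exact inner_self_eq_zero.1 h1
    · intro b _ hb
      refine hort _ _ ?_ _ (hV _) _ (hV _)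
      intro h
      apply hb
      ext
      simp only at h ⊢
      omega
    · simp
  · intro w hw
    simp only at hz'
    rw [← hsum', inner_sum, hz', Finset.sum_eq_single ⟨j, by omega⟩]
    · intro b _ hb
      refine hort _ _ ?_ _ hw _ (hf b)
      intro h
      apply hb
      ext
      exact h.symm
    · simp

lemma pow_inner (V : H →ₗ[ℂ] H) (hV : IsPartialIsometry V)
    (L : Submodule ℂ H) (m : ℕ) (hshift : IsShiftOnWith V (⊤ : Submodule ℂ H) L m)
    (t : ℕ) (ht : t ≤ m) (x : H) (hx : x ∈ L ⊓ (LinearMap.ker (V ^ t))ᗮ) (j : ℕ) (hj : j ≤ t) :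
    ∀ z, ⟪(V ^ j) x, (V ^ j) z⟫_ℂ = ⟪x, z⟫_ℂ := by
  induction j with
  | zero => simp
  | succ j ih =>
    have ih := ih (by omega)
    have hs : (V ^ j) x ∈ supp V := by
      refine (Submodule.mem_orthogonal' _ _).2 fun y hy => ?_
      obtain ⟨z, hz, hz0, hw⟩ := graded_ker V L m hshift 1 j (by omega) y (by simpa using hy)
      rw [hw _ ⟨x, hx.1, rfl⟩, ih]
      refine (Submodule.mem_orthogonal' _ _).1 hx.2 z ?_
      rw [LinearMap.mem_ker, show t = (t - (1 + j)) + (1 + j) by omega, pow_add,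
        Module.End.mul_apply, hz0, map_zero]
    intro z
    rw [pow_succ', Module.End.mul_apply, Module.End.mul_apply, ← LinearMap.adjoint_inner_left]
    have := LinearMap.congr_fun hV ((V ^ j) x)
    rw [LinearMap.comp_apply, projOf_of_mem _ hs] at this
    rw [this, ih]

lemma code_ne_bot (V : H →ₗ[ℂ] H)
    (L : Submodule ℂ H) (m : ℕ) (hshift : IsShiftOnWith V (⊤ : Submodule ℂ H) L m)
    (t : ℕ) (ht : t ≤ m) : L ⊓ (LinearMap.ker (V ^ t))ᗮ ≠ ⊥ := by
  intro hbot
  have hle : L ≤ LinearMap.ker (V ^ t) := by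
    intro x hx
    let D := L ⊓ LinearMap.ker (V ^ t)
    have hp := projOf_mem D x
    have hd : x - projOf D x ∈ L ⊓ (LinearMap.ker (V ^ t))ᗮ := by
      have hL : x - projOf D x ∈ L := Submodule.sub_mem _ hx hp.1
      refine ⟨hL, (Submodule.mem_orthogonal' _ _).2 fun y hy => ?_⟩
      obtain ⟨z, hz, hz0, hw⟩ := graded_ker V L m hshift t 0 (by omega) y (by simpa using hy)
      rw [hw _ ⟨_, hL, by simp⟩]
      exact (Submodule.mem_orthogonal' _ _).1 (sub_projOf_mem D x) z ⟨hz, hz0⟩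
    rw [hbot, Submodule.mem_bot, sub_eq_zero] at hd
    rw [hd]
    exact hp.2
  apply hshift.1.2.1
  rw [eq_bot_iff]
  rintro _ ⟨x, hx, rfl⟩
  rw [Submodule.mem_bot, show m = (m - t) + t by omega, pow_add, Module.End.mul_apply,
    LinearMap.mem_ker.1 (hle hx), map_zero]

lemma state_eq (C : Submodule ℂ H) (ρ : H →ₗ[ℂ] H) (h : IsStateOn C ρ) :
    ρ * projOf C = ρ ∧ projOf C * ρ = ρ := by
  have h1 : ρ * projOf C = ρ := by
    ext x
    have h2 : x - projOf C x ∈ LinearMap.ker ρ := by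
      have := Submodule.orthogonal_le h.2.2.2 (sub_projOf_mem C x)
      rwa [supp, Submodule.orthogonal_orthogonal] at this
    rw [LinearMap.mem_ker, map_sub, sub_eq_zero] at h2
    exact h2.symm
  refine ⟨h1, ?_⟩
  have h2 : star ρ = ρ := h.1
  have := congrArg star h1
  rwa [star_mul, projOf_star, h2] at this

/-- Decoding noise bases give correctable codes. -/
lemma decodes_of_basis (C : Submodule ℂ H) (n : ℕ) (A : Fin n → (H →ₗ[ℂ] H))
    (hA : ∀ j k, projOf C * star (A j) * (A k * projOf C) = if j = k then projOf C else 0) :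
    ∃ Φ, Decodes (Submodule.span ℂ (Set.range A)) C Φ := by
  set P := projOf C with hP
  have hPs : star P = P := projOf_star C
  have hPP : P * P = P := projOf_mul_self C
  let Q : H →ₗ[ℂ] H := ∑ j, A j * P * (P * star (A j))
  have hQA : ∀ k, Q * (A k * P) = A k * P := by
    intro k
    simp only [Q, Finset.sum_mul]
    rw [Finset.sum_eq_single k]
    · rw [mul_assoc, hA, if_pos rfl, mul_assoc, hPP]
    · intro b _ hb
      rw [mul_assoc, hA, if_neg hb, mul_zero]
    · simp
  have hQs : star Q = Q := by
    simp only [Q, star_sum, star_mul, star_star, hPs]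
  have hQQ : Q * Q = Q := by
    conv_lhs => rhs; simp only [Q]
    rw [Finset.mul_sum]
    refine Finset.sum_congr rfl fun j _ => ?_
    rw [← mul_assoc, hQA]
  let K : Fin (n + 1) → (H →ₗ[ℂ] H) := Fin.cons (1 - Q) (fun j => P * star (A j))
  refine ⟨fun ρ => ∑ j, K j ∘ₗ ρ ∘ₗ LinearMap.adjoint (K j), ⟨n + 1, K, ?_, fun _ => rfl⟩, ?_⟩
  · change ∑ j, star (K j) * K j = 1
    rw [Fin.sum_univ_succ]
    simp only [K, Fin.cons_zero, Fin.cons_succ, star_sub, star_one, hQs, star_mul, star_star, hPs]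
    change (1 - Q) * (1 - Q) + Q = 1
    rw [mul_sub, sub_mul, sub_mul, hQQ]
    simp
  · intro ρ hρ N hN
    obtain ⟨h1, h2⟩ := state_eq C ρ hρ
    obtain ⟨c, rfl⟩ := (Submodule.mem_span_range_iff_exists_fun ℂ).1 hN
    set N := ∑ i, c i • A i with hNdef
    have hKN : ∀ j, P * star (A j) * (N * P) = c j • P := by
      intro j
      simp only [hNdef, Finset.sum_mul, Finset.mul_sum, smul_mul_assoc, mul_smul_comm, hA]
      simp
    have hQN : Q * (N * P) = N * P := by
      simp only [hNdef, Finset.sum_mul, Finset.mul_sum, smul_mul_assoc, mul_smul_comm, hQA]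
    have hNN : P * star N * (N * P) = (∑ j, star (c j) * c j) • P := by
      have : P * star N = ∑ j, star (c j) • (P * star (A j)) := by
        simp only [hNdef, star_sum, star_smul, Finset.mul_sum, mul_smul_comm]
      rw [this, Finset.sum_mul, Finset.sum_smul]
      simp only [smul_mul_assoc, hKN, smul_smul]
    have hρ' : ρ = P * ρ * P := by rw [hP, h2, h1]
    have htr : LinearMap.trace ℂ H (ρ * (star N * N)) = ∑ j, star (c j) * c j := by
      have e : ρ * (star N * N) = (P * ρ) * (P * (star N * N)) := by
        rw [h2, ← mul_assoc ρ P, h1]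
      have e2 : LinearMap.trace ℂ H (P * (ρ * (P * (star N * N))))
        = LinearMap.trace ℂ H ((ρ * (P * (star N * N))) * P) := LinearMap.trace_mul_comm ℂ _ _
      have e3 : (ρ * (P * (star N * N))) * P = ρ * (P * star N * (N * P)) := by
        simp only [mul_assoc]
      rw [e, mul_assoc, e2, e3, hNN, mul_smul_comm, h1, map_smul, hρ.2.2.1, smul_eq_mul, mul_one]
    change ∑ j, K j * ((N * (ρ * star N)) * star (K j)) =
      LinearMap.trace ℂ H (ρ * (star N * N)) • ρ
    rw [htr, Fin.sum_univ_succ]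
    have key : ∀ X : H →ₗ[ℂ] H, X * ((N * (ρ * star N)) * star X)
        = (X * (N * P)) * ρ * star (X * (N * P)) := by
      intro X
      rw [star_mul, star_mul, hPs]
      conv_lhs => rw [hρ']
      simp only [mul_assoc]
    simp only [key]
    have z0 : K 0 * (N * P) = 0 := by
      simp only [K, Fin.cons_zero, sub_mul, one_mul, hQN, sub_self]
    rw [z0, zero_mul, zero_mul, zero_add, Finset.sum_smul]
    refine Finset.sum_congr rfl fun j _ => ?_
    have z1 : K j.succ * (N * P) = c j • P := by
      simp only [K, Fin.cons_succ, hKN]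
    rw [z1, star_smul, hPs, smul_mul_assoc, smul_mul_assoc, mul_smul_comm, h2, h1, smul_smul,
      mul_comm]

/-- **Theorem 4.9 (first part).**  For a unilateral shift `V` with wandering space
`(L, m)` and `0 ≤ t ≤ m`, the code `C_t = L ⊓ (ker V^t)ᗮ` is nonzero,
`{V^0, …, V^t}` is a `C_t`-decoding noise basis of `𝒩_t = span{V^j : j ≤ t}`, and `C_t`
is a quantum `𝒩_t`-correcting code. -/
theorem shift_powers_decoding_basis
    (V : H →ₗ[ℂ] H) (hV : IsPartialIsometry V)
    (L : Submodule ℂ H) (m : ℕ) (hshift : IsShiftOnWith V (⊤ : Submodule ℂ H) L m)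
    (t : ℕ) (ht : t ≤ m) :
    (L ⊓ (LinearMap.ker (V ^ t))ᗮ ≠ ⊥) ∧
    IsDecodingNoiseBasis (L ⊓ (LinearMap.ker (V ^ t))ᗮ)
      (fun j : Fin (t + 1) => V ^ (j : ℕ)) ∧
    ∃ Φ, Decodes (Submodule.span ℂ (Set.range fun j : Fin (t + 1) => V ^ (j : ℕ)))
      (L ⊓ (LinearMap.ker (V ^ t))ᗮ) Φ := by
  set C := L ⊓ (LinearMap.ker (V ^ t))ᗮ with hC
  have hne : C ≠ ⊥ := code_ne_bot V L m hshift t ht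
  have hin : ∀ x ∈ C, ∀ j : Fin (t + 1), ∀ z, ⟪(V ^ (j : ℕ)) x, (V ^ (j : ℕ)) z⟫_ℂ = ⟪x, z⟫_ℂ :=
    fun x hx j => pow_inner V hV L m hshift t ht x hx j (by omega)
  have hort : ∀ j k : Fin (t + 1), j ≠ k → ∀ u ∈ C, ∀ v ∈ C,
      ⟪(V ^ (j : ℕ)) u, (V ^ (k : ℕ)) v⟫_ℂ = 0 := fun j k hjk u hu v hv =>
    hshift.2.1 j k (fun h => hjk (Fin.ext h)) _ ⟨u, hu.1, rfl⟩ _ ⟨v, hv.1, rfl⟩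
  have hA : ∀ j k : Fin (t + 1), projOf C * star (V ^ (j : ℕ)) * (V ^ (k : ℕ) * projOf C)
      = if j = k then projOf C else 0 := by
    intro j k
    ext x
    refine ext_inner_left ℂ fun y => ?_
    have e : ⟪y, (projOf C * star (V ^ (j : ℕ)) * (V ^ (k : ℕ) * projOf C)) x⟫_ℂ
        = ⟪(V ^ (j : ℕ)) (projOf C y), (V ^ (k : ℕ)) (projOf C x)⟫_ℂ := by
      simp only [Module.End.mul_apply]
      rw [← projOf_inner, LinearMap.star_eq_adjoint, LinearMap.adjoint_inner_right]
    rw [e]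
    split_ifs with h
    · subst h
      rw [hin _ (projOf_mem C y), projOf_inner, projOf_of_mem C (projOf_mem C x)]
    · rw [hort j k h _ (projOf_mem C y) _ (projOf_mem C x)]
      simp
  refine ⟨hne, ⟨?_, ?_, hort⟩, decodes_of_basis C (t + 1) _ hA⟩
  · obtain ⟨x, hx, hx0⟩ := Submodule.exists_mem_ne_zero_of_ne_bot hne
    rw [Fintype.linearIndependent_iff]
    intro c hc k
    have h1 := LinearMap.congr_fun hc x
    rw [LinearMap.sum_apply, LinearMap.zero_apply] at h1
    have h2 : ⟪(V ^ (k : ℕ)) x, ∑ j, (c j • V ^ (j : ℕ)) x⟫_ℂ = 0 := by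
      rw [h1, inner_zero_right]
    rw [inner_sum, Finset.sum_eq_single k] at h2
    · rw [LinearMap.smul_apply, inner_smul_right, hin x hx] at h2
      exact (mul_eq_zero.1 h2).resolve_right (fun h => hx0 (inner_self_eq_zero.1 h))
    · intro b _ hb
      rw [LinearMap.smul_apply, inner_smul_right, hort k b hb.symm x hx x hx, mul_zero]
    · simp
  · intro j
    have h1 : star (V ^ (j : ℕ) * projOf C) * (V ^ (j : ℕ) * projOf C) = projOf C := by
      rw [star_mul, projOf_star, hA, if_pos rfl]
    have hk : LinearMap.ker (V ^ (j : ℕ) * projOf C) = LinearMap.ker (projOf C) := by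
      ext x
      simp only [LinearMap.mem_ker]
      constructor
      · intro h
        rw [← h1, Module.End.mul_apply, h, map_zero]
      · intro h
        rw [Module.End.mul_apply, h, map_zero]
    have hs : supp (V ^ (j : ℕ) * projOf C) = C := by
      rw [supp, hk, ker_projOf, Submodule.orthogonal_orthogonal]
    refine ⟨?_, hs⟩
    change star (V ^ (j : ℕ) * projOf C) * (V ^ (j : ℕ) * projOf C)
      = projOf (supp (V ^ (j : ℕ) * projOf C))
    rw [h1, hs]
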